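/- arXiv:1903.11271 — 4 statements merged into one kernel-verified Lean document; each statement's English description precedes it below -/
import Mathlib

section
/- Let K be a number field satisfying the abc-inequality for units. Then for every ε > 0 there exists a constant C > 0 such that for every unit u of O_K and every positive integer n with u^n ≠ 1, the squarefull part J_n of the principal ideal (u^n − 1) of O_K satisfies N(J_n) ≤ C·|N_{K/ℚ}(u^n − 1)|^{2ε}. -/
open NumberField

/-- The radical `Rad(I) = ∏_{𝔭 prime, 𝔭 ⊇ I} N(𝔭)` of a nonzero ideal, computed as the
absolute norm of the radical ideal. -/
noncomputable def Rad {K : Type*} [Field K] [NumberField K] (I : Ideal (𝓞 K)) : ℕ :=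
  Ideal.absNorm I.radical

/-- In a Dedekind domain, the square of the radical of a squarefull ideal divides the ideal. -/
lemma Ideal.radical_sq_dvd_of_squarefull {R : Type*} [CommRing R] [IsDedekindDomain R]
    {J : Ideal R} (hJ : J ≠ ⊥) (h : ∀ P : Ideal R, P.IsPrime → P ∣ J → P ^ 2 ∣ J) :
    J.radical ^ 2 ∣ J := by
  classical
  set S := (UniqueFactorizationMonoid.normalizedFactors J).toFinset with hS
  have hprime : ∀ P ∈ S, P.IsPrime ∧ P ≠ ⊥ ∧ P ∣ J := by
    intro P hP
    rw [hS, Multiset.mem_toFinset] at hP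
    have hp := UniqueFactorizationMonoid.prime_of_normalized_factor P hP
    exact ⟨Ideal.isPrime_of_prime hp, hp.ne_zero,
      UniqueFactorizationMonoid.dvd_of_mem_normalizedFactors hP⟩
  have hrad : J.radical ∣ ∏ P ∈ S, P := by
    rw [Ideal.dvd_iff_le, Ideal.radical_eq_sInf]
    refine le_sInf ?_
    rintro P ⟨hJP, hP⟩
    have hP0 : P ≠ ⊥ := by
      rintro rfl
      exact hJ (le_bot_iff.mp hJP)
    have hmem : P ∈ S := by
      rw [hS, Multiset.mem_toFinset, UniqueFactorizationMonoid.mem_normalizedFactors_iff hJ]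
      exact ⟨Ideal.prime_of_isPrime hP0 hP, Ideal.dvd_iff_le.mpr hJP⟩
    exact Ideal.le_of_dvd (Finset.dvd_prod_of_mem _ hmem)
  have hsq : (∏ P ∈ S, P) ^ 2 ∣ J := by
    rw [← Finset.prod_pow]
    refine Finset.prod_dvd_of_coprime ?_ fun P hP => h P (hprime P hP).1 (hprime P hP).2.2
    intro P hP Q hQ hPQ
    have hPm := (hprime P hP).1.isMaximal (hprime P hP).2.1
    have hQm := (hprime Q hQ).1.isMaximal (hprime Q hQ).2.1
    exact (Ideal.isCoprime_iff_sup_eq.mpr (hPm.coprime_of_ne hQm hPQ)).pow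
  exact (pow_dvd_pow_of_dvd hrad 2).trans hsq

/-- The radical of a product of nonzero ideals has norm at most `N(I) * N(√J)`. -/
lemma rad_mul_le {K : Type*} [Field K] [NumberField K] {I J : Ideal (𝓞 K)}
    (hI : I ≠ ⊥) (hJ : J ≠ ⊥) : Rad (I * J) ≤ Ideal.absNorm I * Rad J := by
  have hdvd : (I * J).radical ∣ I * J.radical := by
    rw [Ideal.dvd_iff_le, Ideal.radical_mul]
    exact Ideal.mul_le_inf.trans (inf_le_inf_right _ Ideal.le_radical)
  have hJr : J.radical ≠ ⊥ := ne_bot_of_le_ne_bot hJ Ideal.le_radical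
  unfold Rad
  rw [← map_mul]
  refine Nat.le_of_dvd (Nat.pos_of_ne_zero ?_) (Ideal.absNorm_dvd_absNorm_of_le
    (Ideal.le_of_dvd hdvd))
  rw [Ne, Ideal.absNorm_eq_zero_iff]
  exact mul_ne_zero hI hJr

/-- If `a * b ≤ C * (a * r) ^ (1 + ε)` with `r ^ 2 ≤ b`, then `b` is small compared
with `a * b`. -/
lemma le_mul_rpow_of_le_mul_rpow_one_add {a b r C ε : ℝ} (ha : 1 ≤ a) (hb : 1 ≤ b)
    (hr : 0 ≤ r) (hrb : r ^ 2 ≤ b) (hε : 0 < ε)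
    (h : a * b ≤ C * (a * r) ^ (1 + ε)) : b ≤ C ^ 2 * (a * b) ^ (2 * ε) := by
  have ha0 : 0 < a := by linarith
  have hb0 : 0 < b := by linarith
  have har : (a * r) ^ 2 * b ≤ (a * b) ^ 2 := by
    have : a ^ 2 * b * r ^ 2 ≤ a ^ 2 * b * b := by gcongr
    linarith
  have har' : (a * r) ^ 2 ≤ (a * b) ^ 2 / b := (le_div_iff₀ hb0).mpr har
  have hle : a * r ≤ a * b := by
    have : r ≤ b := by nlinarith
    gcongr
  have hsq : (a * b) ^ 2 ≤ C ^ 2 * ((a * b) ^ 2 / b * (a * b) ^ (2 * ε)) := by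
    calc (a * b) ^ 2 ≤ (C * (a * r) ^ (1 + ε)) ^ 2 := by gcongr
      _ = C ^ 2 * ((a * r) ^ 2 * (a * r) ^ (2 * ε)) := by
        rcases hr.eq_or_lt with rfl | hr0
        · simp [Real.zero_rpow (by positivity : 1 + ε ≠ 0)]
        · have : 0 < a * r := by positivity
          rw [Real.rpow_add this, Real.rpow_one, two_mul ε, Real.rpow_add this]
          ring
      _ ≤ _ := by gcongr
  have : (a * b) ^ 2 * b ≤ (a * b) ^ 2 * (C ^ 2 * (a * b) ^ (2 * ε)) := by
    calc (a * b) ^ 2 * b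
        ≤ C ^ 2 * ((a * b) ^ 2 / b * (a * b) ^ (2 * ε)) * b := by gcongr
      _ = _ := by field_simp
  exact le_of_mul_le_mul_left this (by positivity)

/-- Let `K` satisfy the abc-inequality for units. Then for every `ε > 0`
there is `C > 0` such that for every unit `u` of `𝓞 K` and every `n ≥ 1` with `u^n ≠ 1`,
the squarefull part `J_n` of the ideal `(u^n − 1)` satisfies
`N(J_n) ≤ C · |N_{K/ℚ}(u^n − 1)|^(2ε)`. -/
theorem norm_squarefull_part_le
    (K : Type*) [Field K] [NumberField K]
    (habc : ∀ ε : ℝ, 0 < ε → ∃ C : ℝ, 0 < C ∧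
      ∀ u₁ u₂ : (𝓞 K)ˣ, u₁ ≠ u₂ →
        |((Algebra.norm ℤ ((u₁ : 𝓞 K) - (u₂ : 𝓞 K)) : ℤ) : ℝ)| ≤
          C * (Rad (Ideal.span {(u₁ : 𝓞 K) - (u₂ : 𝓞 K)}) : ℝ) ^ (1 + ε)) :
    ∀ ε : ℝ, 0 < ε → ∃ C : ℝ, 0 < C ∧
      ∀ (u : (𝓞 K)ˣ) (n : ℕ), 0 < n → (u : 𝓞 K) ^ n ≠ 1 →
        ∀ I J : Ideal (𝓞 K),
          Ideal.span {(u : 𝓞 K) ^ n - 1} = I * J → IsCoprime I J → Squarefree I →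
          (∀ P : Ideal (𝓞 K), P.IsPrime → P ∣ J → P ^ 2 ∣ J) →
            (Ideal.absNorm J : ℝ) ≤
              C * |((Algebra.norm ℤ ((u : 𝓞 K) ^ n - 1) : ℤ) : ℝ)| ^ (2 * ε) := by
  intro ε hε
  obtain ⟨C, hC, h⟩ := habc ε hε
  refine ⟨C ^ 2, by positivity, ?_⟩
  intro u n _ hun I J hIJ _ _ hsf
  have hne : Ideal.span {(u : 𝓞 K) ^ n - 1} ≠ ⊥ := by
    rw [Ne, Ideal.span_singleton_eq_bot, sub_eq_zero]
    exact hun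
  have hI : I ≠ ⊥ := by
    rintro rfl
    exact hne (by simp [hIJ])
  have hJ : J ≠ ⊥ := by
    rintro rfl
    exact hne (by simp [hIJ])
  have hpos : ∀ L : Ideal (𝓞 K), L ≠ ⊥ → 1 ≤ Ideal.absNorm L := fun L hL =>
    Nat.one_le_iff_ne_zero.mpr (by rwa [Ne, Ideal.absNorm_eq_zero_iff])
  have hnorm : |((Algebra.norm ℤ ((u : 𝓞 K) ^ n - 1) : ℤ) : ℝ)| =
      (Ideal.absNorm I : ℝ) * Ideal.absNorm J := by
    rw [← Nat.cast_mul, ← map_mul, ← hIJ, Ideal.absNorm_span_singleton, Nat.cast_natAbs,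
      Int.cast_abs]
  have habcu := h (u ^ n) 1 fun hu => hun (by simpa using congrArg Units.val hu)
  simp only [Units.val_pow_eq_pow_val, Units.val_one] at habcu
  rw [hIJ, hnorm] at habcu
  have hrad : Rad J ^ 2 ≤ Ideal.absNorm J := by
    unfold Rad
    rw [← map_pow]
    exact Nat.le_of_dvd (hpos J hJ) (Ideal.absNorm_dvd_absNorm_of_le
      (Ideal.le_of_dvd (Ideal.radical_sq_dvd_of_squarefull hJ hsf)))
  rw [hnorm]
  refine le_mul_rpow_of_le_mul_rpow_one_add (r := Rad J) (by exact_mod_cast hpos I hI)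
    (by exact_mod_cast hpos J hJ) (Nat.cast_nonneg _) (by exact_mod_cast hrad) hε
    (habcu.trans ?_)
  gcongr
  exact_mod_cast rad_mul_le hI hJ
end

section
/- Let K be a number field of degree m satisfying the abc-inequality for units, and let u be a unit of O_K such that there exists c > 0 with |N_{K/ℚ}(Φ_n(u))| ≥ exp(c·n) for every positive integer n with 2·φ(n) ≥ n. Then there exist a real number γ > 1 and a positive integer n₀ such that for every integer n ≥ n₀ with 2·φ(n) ≥ n, there exists a prime ideal 𝔭 of O_K satisfying: (i) Φ_n(u) ∈ 𝔭 and u^n − 1 ∉ 𝔭²; (ii) the image of u in the unit group (O_K/𝔭)^× has order exactly n; (iii) N(𝔭) ≤ γ^n. -/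
open NumberField Polynomial

theorem Ideal.radical_dvd_ufm_radical {R : Type*} [CommRing R] [IsDedekindDomain R]
    {I : Ideal R} (hI : I ≠ ⊥) :
    I.radical ∣ UniqueFactorizationMonoid.radical I := by
  obtain ⟨k, hk⟩ := UniqueFactorizationMonoid.exists_dvd_radical_self_pow hI
  rw [Ideal.dvd_iff_le] at hk ⊢
  exact fun x hx => ⟨k, hk (Ideal.pow_mem_pow hx k)⟩

theorem Ideal.ufm_radical_sq_dvd {R : Type*} [CommRing R] [IsDedekindDomain R] {J X : Ideal R}
    (h : ∀ p : Ideal R, Prime p → p ∣ J → p ^ 2 ∣ X) :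
    UniqueFactorizationMonoid.radical J ^ 2 ∣ X := by
  rw [UniqueFactorizationMonoid.radical, ← Finset.prod_pow]
  refine Finset.prod_dvd_of_isRelPrime ?_ ?_
  · intro p hp q hq hpq
    exact (UniqueFactorizationMonoid.pairwise_primeFactors_isRelPrime hp hq hpq).pow
  · intro p hp
    rw [UniqueFactorizationMonoid.mem_primeFactors] at hp
    exact h p (UniqueFactorizationMonoid.prime_of_normalized_factor p hp)
      (UniqueFactorizationMonoid.dvd_of_mem_normalizedFactors hp)

theorem Polynomial.exists_cyclotomic_cofactor {R : Type*} [CommRing R] (n : ℕ) (u : R) :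
    ∃ w s t : R, u ^ n - 1 = eval u (cyclotomic n R) * w ∧
      (n : R) * u ^ (n - 1) = s * w + eval u (cyclotomic n R) * t := by
  obtain ⟨W, hW⟩ := cyclotomic.dvd_X_pow_sub_one n R
  refine ⟨eval u W, eval u (derivative (cyclotomic n R)), eval u (derivative W), ?_, ?_⟩
  · simpa using congrArg (eval u) hW
  · simpa [derivative_X_pow] using congrArg (fun p => eval u (derivative p)) hW

theorem NumberField.exists_norm_pow_sub_one_le {K : Type*} [Field K] [NumberField K] (u : 𝓞 K) :
    ∃ γ : ℝ, 1 < γ ∧ ∀ n : ℕ, n ≠ 0 → |((Algebra.norm ℤ (u ^ n - 1) : ℤ) : ℝ)| ≤ γ ^ n := by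
  have h1 : 1 ≤ ∏ φ : K →ₐ[ℚ] ℂ, (‖φ u‖ + 1) :=
    Finset.prod_induction _ (fun x : ℝ => 1 ≤ x) (fun _ _ => one_le_mul_of_one_le_of_one_le) le_rfl
      fun φ _ => by simp
  refine ⟨(∏ φ : K →ₐ[ℚ] ℂ, (‖φ u‖ + 1)) + 1, by linarith, fun n hn => ?_⟩
  refine le_trans ?_ (pow_le_pow_left₀ (by linarith) (le_add_of_nonneg_right zero_le_one) n)
  have key : ((Algebra.norm ℤ (u ^ n - 1) : ℤ) : ℂ) =
      ∏ φ : K →ₐ[ℚ] ℂ, φ ((u ^ n - 1 : 𝓞 K) : K) := by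
    rw [← Algebra.norm_eq_prod_embeddings ℚ ℂ, ← Algebra.coe_norm_int]
    simp
  have : |((Algebra.norm ℤ (u ^ n - 1) : ℤ) : ℝ)| = ‖((Algebra.norm ℤ (u ^ n - 1) : ℤ) : ℂ)‖ := by
    simp
  rw [this, key, norm_prod, ← Finset.prod_pow]
  refine Finset.prod_le_prod (fun _ _ => norm_nonneg _) fun φ _ => ?_
  have : φ ((u ^ n - 1 : 𝓞 K) : K) = (φ u) ^ n - 1 := by simp
  rw [this]
  calc _ ≤ ‖φ u‖ ^ n + 1 ^ n := by simpa using norm_sub_le (φ u ^ n) 1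
    _ ≤ _ := pow_add_pow_le (norm_nonneg _) zero_le_one hn

theorem Rad_mul_sq_le {K : Type*} [Field K] [NumberField K] {a w : 𝓞 K} {n : ℕ} (hn : n ≠ 0)
    (haw : a * w ≠ 0)
    (h : ∀ p : Ideal (𝓞 K), p.IsPrime → p ≠ ⊥ → a ∈ p → (n : 𝓞 K) ∉ p → a ∈ p ^ 2) :
    Rad (Ideal.span {a * w}) ^ 2 ≤ (Algebra.norm ℤ a).natAbs * n ^ Module.finrank ℚ K *
      (Algebra.norm ℤ w).natAbs ^ 2 := by
  have ha : Ideal.span {a} ≠ ⊥ := by simpa using left_ne_zero_of_mul haw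
  have hn' : (n : 𝓞 K) ≠ 0 := by exact_mod_cast hn
  have hsq : UniqueFactorizationMonoid.radical (Ideal.span {a}) ^ 2 ∣
      Ideal.span {a} * Ideal.span {(n : 𝓞 K)} := by
    refine Ideal.ufm_radical_sq_dvd fun p hp hpa => ?_
    by_cases hpn : (n : 𝓞 K) ∈ p
    · rw [sq]
      exact mul_dvd_mul hpa (by rwa [Ideal.dvd_span_singleton])
    · refine Dvd.dvd.mul_right ?_ _
      rw [Ideal.dvd_span_singleton] at hpa ⊢
      exact h p (Ideal.isPrime_of_prime hp) hp.ne_zero hpa hpn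
  have hrad : (Ideal.span {a * w}).radical ∣
      UniqueFactorizationMonoid.radical (Ideal.span {a}) * Ideal.span {w} := by
    have hne : Ideal.span {a * w} ≠ ⊥ := by simpa using haw
    refine (Ideal.radical_dvd_ufm_radical hne).trans ?_
    rw [← Ideal.span_singleton_mul_span_singleton]
    exact UniqueFactorizationMonoid.radical_mul_dvd.trans
      (mul_dvd_mul_left _ UniqueFactorizationMonoid.radical_dvd_self)
  have h1 := map_dvd (Ideal.absNorm (S := 𝓞 K)) (pow_dvd_pow_of_dvd hrad 2)
  have h2 := map_dvd (Ideal.absNorm (S := 𝓞 K))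
    (mul_dvd_mul hsq (dvd_refl (Ideal.span {w} ^ 2)))
  rw [← mul_pow] at h2
  have h3 := h1.trans h2
  rw [map_pow, map_mul, map_mul, map_pow, Ideal.absNorm_span_natCast,
    Ideal.absNorm_span_singleton, Ideal.absNorm_span_singleton, RingOfIntegers.rank] at h3
  refine Nat.le_of_dvd ?_ h3
  have := Int.natAbs_pos.2
    (Algebra.norm_ne_zero_iff.2 (left_ne_zero_of_mul haw) : Algebra.norm ℤ a ≠ 0)
  have := Int.natAbs_pos.2
    (Algebra.norm_ne_zero_iff.2 (right_ne_zero_of_mul haw) : Algebra.norm ℤ w ≠ 0)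
  positivity

theorem Ideal.mem_pow_of_mul_mem_pow {R : Type*} [CommRing R] [IsDedekindDomain R]
    {p : Ideal R} (hp : p.IsPrime) (hp0 : p ≠ ⊥) {a b : R} {k : ℕ} (h : a * b ∈ p ^ k) (hb : b ∉ p) :
    a ∈ p ^ k := by
  rw [← Ideal.dvd_span_singleton] at h hb ⊢
  rw [← Ideal.span_singleton_mul_span_singleton] at h
  exact (Ideal.prime_of_isPrime hp0 hp).pow_dvd_of_dvd_mul_right k hb h

theorem Units.orderOf_map_mk_eq {R : Type*} [CommRing R] {p : Ideal R} (hp : p.IsPrime) (u : Rˣ)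
    {n : ℕ} (hn : (n : R) ∉ p) (hu : eval (u : R) (cyclotomic n R) ∈ p) :
    orderOf (Units.map (Ideal.Quotient.mk p).toMonoidHom u) = n := by
  have : NeZero ((n : ℕ) : R ⧸ p) := ⟨by
    rw [← map_natCast (Ideal.Quotient.mk p)]
    rwa [Ne, Ideal.Quotient.eq_zero_iff_mem]⟩
  have hroot : (cyclotomic n (R ⧸ p)).IsRoot (Ideal.Quotient.mk p u) := by
    rw [IsRoot, ← map_cyclotomic n (Ideal.Quotient.mk p), eval_map, eval₂_hom]
    exact Ideal.Quotient.eq_zero_iff_mem.2 hu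
  rw [← orderOf_units]
  exact (isRoot_cyclotomic_iff.1 hroot).eq_orderOf.symm

/-- For suitable `ε`, an `abc`-type bound with exponent `1 + ε` on `a + b` in logarithmic form fails
for all large `n` as soon as `a` grows at least linearly and `a + b` at most linearly. -/
theorem exists_eps_threshold {c L : ℝ} (hc : 0 < c) (hL : 0 < L) (m : ℕ) :
    ∃ ε : ℝ, 0 < ε ∧ ∀ D : ℝ, ∃ n₀ : ℕ, 0 < n₀ ∧ ∀ n : ℕ, n₀ ≤ n →
      m * Real.log n < c * n ∧ ∀ a b : ℝ, c * n ≤ a → 0 ≤ b → a + b ≤ n * L →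
        D + (1 + ε) * ((a + m * Real.log n) / 2 + b) < a + b := by
  refine ⟨c / (4 * (L + c)), by positivity, fun D => ?_⟩
  have hlog : Filter.Tendsto (fun n : ℕ => Real.log n / n) Filter.atTop (nhds 0) :=
    (Real.isLittleO_log_id_atTop.tendsto_div_nhds_zero).comp tendsto_natCast_atTop_atTop
  have hconst : Filter.Tendsto (fun n : ℕ => D / n) Filter.atTop (nhds 0) :=
    tendsto_const_div_atTop_nhds_zero_nat D
  have hsum : Filter.Tendsto (fun n : ℕ => D / n + m * (Real.log n / n)) Filter.atTop (nhds 0) := by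
    simpa using hconst.add (hlog.const_mul (m : ℝ))
  have hlog' : Filter.Tendsto (fun n : ℕ => m * (Real.log n / n)) Filter.atTop (nhds 0) := by
    simpa using hlog.const_mul (m : ℝ)
  obtain ⟨N, hN⟩ := Filter.eventually_atTop.1
    ((hsum.eventually_lt_const (show (0 : ℝ) < c / 4 by positivity)).and
      (hlog'.eventually_lt_const hc))
  refine ⟨N + 1, N.succ_pos, fun n hn => ?_⟩
  obtain ⟨h1, h2⟩ := hN n (by omega)
  have hn0 : (0 : ℝ) < n := by exact_mod_cast (by omega : 0 < n)
  rw [mul_div_assoc', ← add_div, div_lt_iff₀ hn0] at h1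
  rw [mul_div_assoc', div_lt_iff₀ hn0] at h2
  refine ⟨h2, fun a b ha hb hab => ?_⟩
  set ε := c / (4 * (L + c)) with hε
  have hε1 : ε * (4 * (L + c)) = c := by rw [hε]; field_simp
  have hε0 : 0 < ε := by positivity
  have hεle : ε ≤ 1 / 4 := by nlinarith
  have hlog0 : 0 ≤ m * Real.log n := by positivity
  have e1 : ε * (m * Real.log n) ≤ 1 / 4 * (m * Real.log n) := by gcongr
  have e2 : ε * (a + b) ≤ ε * (n * L) := by gcongr
  have e3 : ε * (4 * (L + c)) * n = c * n := by rw [hε1]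
  have e4 : 0 ≤ ε * c * n := by positivity
  have e5 : (1 - ε) * (c * n) ≤ (1 - ε) * a := by gcongr; linarith
  nlinarith [mul_nonneg hε0.le hb]

/-- Let `K` be a number field of degree `m` satisfying the abc-inequality
for units, and `u` a unit of `𝓞 K` such that for some `c > 0` one has
`|N(Φ_n(u))| ≥ exp (c n)` for every `n ≥ 1` with `2 φ(n) ≥ n`. Then there exist `γ > 1`
and `n₀ ≥ 1` such that for every `n ≥ n₀` with `2 φ(n) ≥ n` there is a prime ideal `𝔭`
of `𝓞 K` with: (i) `Φ_n(u) ∈ 𝔭` and `u^n − 1 ∉ 𝔭²`; (ii) the image of `u` in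
`(𝓞 K ⧸ 𝔭)ˣ` has order exactly `n`; (iii) `N(𝔭) ≤ γ^n`. -/
theorem exists_prime_ideal_of_abc
    (K : Type*) [Field K] [NumberField K] (m : ℕ) (hm : Module.finrank ℚ K = m)
    (habc : ∀ ε : ℝ, 0 < ε → ∃ C : ℝ, 0 < C ∧
      ∀ u₁ u₂ : (𝓞 K)ˣ, u₁ ≠ u₂ →
        |((Algebra.norm ℤ ((u₁ : 𝓞 K) - (u₂ : 𝓞 K)) : ℤ) : ℝ)| ≤
          C * (Rad (Ideal.span {(u₁ : 𝓞 K) - (u₂ : 𝓞 K)}) : ℝ) ^ (1 + ε))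
    (u : (𝓞 K)ˣ) (c : ℝ) (hc : 0 < c)
    (hnorm : ∀ n : ℕ, 0 < n → n ≤ 2 * Nat.totient n →
      Real.exp (c * n) ≤
        |((Algebra.norm ℤ (Polynomial.eval (u : 𝓞 K) (cyclotomic n (𝓞 K))) : ℤ) : ℝ)|) :
    ∃ γ : ℝ, 1 < γ ∧ ∃ n₀ : ℕ, 0 < n₀ ∧
      ∀ n : ℕ, n₀ ≤ n → n ≤ 2 * Nat.totient n →
        ∃ 𝔭 : Ideal (𝓞 K), 𝔭.IsPrime ∧ 𝔭 ≠ ⊥ ∧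
          Polynomial.eval (u : 𝓞 K) (cyclotomic n (𝓞 K)) ∈ 𝔭 ∧
          (u : 𝓞 K) ^ n - 1 ∉ 𝔭 ^ 2 ∧
          orderOf (Units.map (Ideal.Quotient.mk 𝔭).toMonoidHom u) = n ∧
          (Ideal.absNorm 𝔭 : ℝ) ≤ γ ^ n := by
  
  obtain ⟨γ, hγ, hupper⟩ := NumberField.exists_norm_pow_sub_one_le (u : 𝓞 K)
  obtain ⟨ε, hε, hthr⟩ := exists_eps_threshold hc (Real.log_pos hγ) m
  obtain ⟨C, hC, habc⟩ := habc ε hε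
  obtain ⟨n₀, hn₀, hthr⟩ := hthr (Real.log C)
  refine ⟨γ, hγ, n₀, hn₀, fun n hn hφ => ?_⟩
  by_contra! hno
  have hnpos : 0 < n := hn₀.trans_le hn
  obtain ⟨hlog, hthr⟩ := hthr n hn
  specialize hnorm n hnpos hφ
  specialize hupper n hnpos.ne'
  obtain ⟨w, s, t, hw, hder⟩ := exists_cyclotomic_cofactor n (u : 𝓞 K)
  set a := eval (u : 𝓞 K) (cyclotomic n (𝓞 K)) with ha
  have hnpos' : (0 : ℝ) < n := by exact_mod_cast hnpos
  have hNa : 0 < |((Algebra.norm ℤ a : ℤ) : ℝ)| := (Real.exp_pos _).trans_le hnorm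
  have hloga : c * n ≤ Real.log |((Algebra.norm ℤ a : ℤ) : ℝ)| :=
    (Real.le_log_iff_exp_le hNa).2 hnorm
  have ha0 : a ≠ 0 := by
    intro h
    simp [h, Algebra.norm_zero] at hNa
  have hw0 : w ≠ 0 := by
    rintro rfl
    rw [mul_zero, zero_add] at hder
    have hdvd : Algebra.norm ℤ a ∣ (n : ℤ) ^ m := by
      have h1 : a ∣ (n : 𝓞 K) :=
        ((u.isUnit.pow (n - 1)).dvd_mul_right).1 ⟨t, hder⟩
      have h2 := map_dvd (Algebra.norm ℤ) h1
      rwa [Algebra.norm_natCast, RingOfIntegers.rank, hm] at h2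
    have hle : |Algebra.norm ℤ a| ≤ (n : ℤ) ^ m :=
      Int.le_of_dvd (by positivity) ((abs_dvd _ _).2 hdvd)
    have hle' : |((Algebra.norm ℤ a : ℤ) : ℝ)| ≤ (n : ℝ) ^ m := by exact_mod_cast hle
    have := Real.log_le_log hNa hle'
    rw [Real.log_pow] at this
    linarith
  have haw : a * w ≠ 0 := mul_ne_zero ha0 hw0
  have hsub : (u : 𝓞 K) ^ n - 1 ≠ 0 := hw ▸ haw
  have hsq : ∀ p : Ideal (𝓞 K), p.IsPrime → p ≠ ⊥ → a ∈ p → (n : 𝓞 K) ∉ p → a ∈ p ^ 2 := by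
    intro p hp hp0 hap hnp
    have hwp : w ∉ p := by
      intro hwp
      have h1 : (n : 𝓞 K) * (u : 𝓞 K) ^ (n - 1) ∈ p :=
        hder ▸ p.add_mem (p.mul_mem_left _ hwp) (p.mul_mem_right _ hap)
      exact (hp.mem_or_mem h1).elim hnp fun h2 =>
        hp.ne_top (p.eq_top_of_isUnit_mem h2 (u.isUnit.pow _))
    by_contra hap2
    have hup2 : (u : 𝓞 K) ^ n - 1 ∉ p ^ 2 := fun h =>
      hap2 (Ideal.mem_pow_of_mul_mem_pow hp hp0 (hw ▸ h) hwp)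
    refine (hno p hp hp0 hap hup2 (Units.orderOf_map_mk_eq hp u hnp hap)).not_ge ?_
    refine le_trans ?_ hupper
    have hmem : (u : 𝓞 K) ^ n - 1 ∈ p := hw ▸ p.mul_mem_right _ hap
    have h1 := Int.le_of_dvd (abs_pos.2 (Algebra.norm_ne_zero_iff.2 hsub))
      ((dvd_abs _ _).2 (Ideal.absNorm_dvd_norm_of_mem hmem))
    exact_mod_cast h1
  have hNw : 1 ≤ |((Algebra.norm ℤ w : ℤ) : ℝ)| := by
    exact_mod_cast Int.one_le_abs (Algebra.norm_ne_zero_iff.2 hw0)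
  have hrad : (Rad (Ideal.span {a * w}) : ℝ) ^ 2 ≤
      |((Algebra.norm ℤ a : ℤ) : ℝ)| * (n : ℝ) ^ m * |((Algebra.norm ℤ w : ℤ) : ℝ)| ^ 2 := by
    have h1 := Rad_mul_sq_le hnpos.ne' haw hsq
    rw [hm] at h1
    have h2 : ((Rad (Ideal.span {a * w}) ^ 2 : ℕ) : ℝ) ≤ _ := Nat.cast_le.2 h1
    simpa [Nat.cast_natAbs] using h2
  have hne : u ^ n ≠ 1 := by
    intro h
    apply hsub
    rw [← Units.val_pow_eq_pow_val, h, Units.val_one, sub_self]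
  have habc' := habc (u ^ n) 1 hne
  rw [Units.val_pow_eq_pow_val, Units.val_one, hw, map_mul, Int.cast_mul, abs_mul] at habc'
  rw [hw, map_mul, Int.cast_mul, abs_mul] at hupper
  have hNw0 : 0 < |((Algebra.norm ℤ w : ℤ) : ℝ)| := one_pos.trans_le hNw
  have hR0 : (0 : ℝ) < Rad (Ideal.span {a * w}) := by
    refine lt_of_le_of_ne (Nat.cast_nonneg _) fun h => ?_
    rw [← h, Real.zero_rpow (by positivity), mul_zero] at habc'
    exact (mul_pos hNa hNw0).not_ge habc'
  have l1 := Real.log_le_log (mul_pos hNa hNw0) hupper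
  have l2 := Real.log_le_log (mul_pos hNa hNw0) habc'
  have l3 := Real.log_le_log (pow_pos hR0 2) hrad
  rw [Real.log_mul hNa.ne' hNw0.ne'] at l1 l2
  rw [Real.log_pow] at l1
  rw [Real.log_mul hC.ne' (by positivity), Real.log_rpow hR0] at l2
  rw [Real.log_mul (by positivity) (by positivity), Real.log_mul hNa.ne' (by positivity),
    Real.log_pow, Real.log_pow, Real.log_pow] at l3
  push_cast at l3
  have key := hthr _ _ hloga (Real.log_nonneg hNw) l1
  have l4 : (1 + ε) * Real.log (Rad (Ideal.span {a * w})) ≤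
      (1 + ε) * ((Real.log |((Algebra.norm ℤ a : ℤ) : ℝ)| + m * Real.log n) / 2 +
        Real.log |((Algebra.norm ℤ w : ℤ) : ℝ)|) := by
    gcongr
    linarith
  linarith
end

section
/- Let K/ℚ be a finite Galois extension with ring of integers O_K, let p be a rational prime, and let 𝔭₀ be a prime ideal of O_K above p whose residue field O_K/𝔭₀ has cardinality q. Let u be a unit of O_K with u − 1 ∈ 𝔭₀ and u − 1 ∉ 𝔭₀². Then the element x = u^{q−1} satisfies: x − 1 ∈ 𝔭 for every prime ideal 𝔭 of O_K above p, and x − 1 ∉ 𝔭₀². -/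
open NumberField

/-- A unit of a commutative ring is a `(N - 1)`-st root of unity modulo a maximal ideal
whose residue field has finite cardinality `N`. -/
theorem Ideal.units_pow_card_quotient_sub_one_sub_one_mem {R : Type*} [CommRing R]
    (I : Ideal R) [I.IsMaximal] [Finite (R ⧸ I)] (u : Rˣ) :
    (u : R) ^ (Nat.card (R ⧸ I) - 1) - 1 ∈ I := by
  let _ := Ideal.Quotient.field I
  have := Fintype.ofFinite (R ⧸ I)
  rw [← Ideal.Quotient.eq, map_pow, map_one, Nat.card_eq_fintype_card]
  exact FiniteField.pow_card_sub_one_eq_one _ (u.isUnit.map (Ideal.Quotient.mk I)).ne_zero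

/-- If `u ≡ 1` modulo `I` but not modulo `I ^ 2`, then the same holds for `u ^ n` as soon as
`n ≡ -1` modulo `I`. -/
theorem Ideal.pow_sub_one_notMem_sq {R : Type*} [CommRing R] {I : Ideal R} {u : R} {n : ℕ}
    (hn : (n : R) + 1 ∈ I) (h1 : u - 1 ∈ I) (h2 : u - 1 ∉ I ^ 2) : u ^ n - 1 ∉ I ^ 2 := by
  intro h
  have hu : Ideal.Quotient.mk I u = 1 := by
    rw [← map_one (Ideal.Quotient.mk I), Ideal.Quotient.eq]
    exact h1
  have hsum : (∑ i ∈ Finset.range n, u ^ i) + 1 ∈ I := by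
    rw [← Ideal.Quotient.eq_zero_iff_mem] at hn ⊢
    simpa [hu] using hn
  have hmul : (u - 1) * ((∑ i ∈ Finset.range n, u ^ i) + 1) ∈ I ^ 2 := by
    rw [sq]
    exact Ideal.mul_mem_mul h1 hsum
  rw [mul_add, mul_one, mul_geom_sum] at hmul
  exact h2 ((Ideal.add_mem_iff_right _ h).mp hmul)

/-- Let `K/ℚ` be a finite Galois extension, `p` a rational prime, and `𝔭₀`
a prime ideal of `𝓞 K` above `p` with residue field of cardinality `q`. If `u` is a unit of
`𝓞 K` with `u ≡ 1 (mod 𝔭₀)` but `u ≢ 1 (mod 𝔭₀²)`, then `x = u^(q−1)` satisfies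
`x ≡ 1 (mod 𝔭)` for every prime ideal `𝔭` above `p`, and `x ≢ 1 (mod 𝔭₀²)`. -/
theorem unit_pow_q_sub_one
    (K : Type*) [Field K] [NumberField K] [IsGalois ℚ K]
    (p : ℕ) (hp : p.Prime)
    (𝔭₀ : Ideal (𝓞 K)) (h𝔭₀ : 𝔭₀.IsPrime)
    (habove : 𝔭₀.comap (algebraMap ℤ (𝓞 K)) = Ideal.span {(p : ℤ)})
    (q : ℕ) (hq : Nat.card (𝓞 K ⧸ 𝔭₀) = q)
    (u : (𝓞 K)ˣ)
    (h1 : (u : 𝓞 K) - 1 ∈ 𝔭₀) (h2 : (u : 𝓞 K) - 1 ∉ 𝔭₀ ^ 2) :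
    (∀ 𝔭 : Ideal (𝓞 K), 𝔭.IsPrime →
        𝔭.comap (algebraMap ℤ (𝓞 K)) = Ideal.span {(p : ℤ)} →
        (u : 𝓞 K) ^ (q - 1) - 1 ∈ 𝔭) ∧
      (u : 𝓞 K) ^ (q - 1) - 1 ∉ 𝔭₀ ^ 2 := by
  have hfin (I : Ideal (𝓞 K)) (hI : I.comap (algebraMap ℤ (𝓞 K)) = Ideal.span {(p : ℤ)}) :
      Finite (𝓞 K ⧸ I) := by
    refine Ideal.finiteQuotientOfFreeOfNeBot I ?_
    rintro rfl
    have hmem : (p : ℤ) ∈ (⊥ : Ideal (𝓞 K)).comap (algebraMap ℤ (𝓞 K)) :=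
      hI ▸ Ideal.mem_span_singleton_self _
    simp [hp.ne_zero] at hmem
  subst hq
  refine ⟨fun 𝔭 h𝔭 h ↦ ?_, Ideal.pow_sub_one_notMem_sq ?_ h1 h2⟩
  · have := hfin 𝔭 h
    have : 𝔭.IsMaximal := Ideal.Quotient.maximal_of_isField _ (Finite.isField_of_domain _)
    have : 𝔭₀.LiesOver (Ideal.span {(p : ℤ)}) := ⟨habove.symm⟩
    have : 𝔭.LiesOver (Ideal.span {(p : ℤ)}) := ⟨h.symm⟩
    obtain ⟨σ, hσ⟩ :=
      Ideal.exists_smul_eq_of_isGaloisGroup (Ideal.span {(p : ℤ)}) 𝔭₀ 𝔭 (K ≃ₐ[ℚ] K)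
    rw [Nat.card_congr (Ideal.quotientEquiv 𝔭₀ 𝔭
      (MulSemiringAction.toRingEquiv (K ≃ₐ[ℚ] K) (𝓞 K) σ) hσ.symm).toEquiv]
    exact Ideal.units_pow_card_quotient_sub_one_sub_one_mem 𝔭 u
  · have := hfin 𝔭₀ habove
    rw [← Nat.cast_succ, Nat.succ_eq_add_one, Nat.sub_add_cancel Nat.card_pos]
    exact Ideal.absNorm_mem 𝔭₀
end

section
/- Let K be a number field satisfying the generalized abc-conjecture: for every ε > 0 there exists a constant C > 0 such that for all nonzero a, b, c ∈ O_K with a + b = c and with the ideals (a) and (b) coprime, one has ∏_v max{|a|_v, |b|_v, |c|_v} ≤ C·Rad((a·b·c))^{1+ε}, the product being over all places v of K with normalized absolute values. Then for every ε > 0 there exists a constant C' > 0 such that for all units u₁ ≠ u₂ of O_K, |N_{K/ℚ}(u₁ − u₂)| ≤ C'·Rad((u₁ − u₂))^{1+ε}. -/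
open NumberField IsDedekindDomain

/-- The normalized absolute value of a (nonzero) algebraic integer `x` at the finite place
corresponding to the nonzero prime ideal `v`: `|x|_v = N(𝔭)^(−v_𝔭(x))`, where `v_𝔭(x)` is
the multiplicity of `𝔭` in the principal ideal `(x)`. -/
noncomputable def finAbs {K : Type*} [Field K] [NumberField K]
    (v : HeightOneSpectrum (𝓞 K)) (x : 𝓞 K) : ℝ :=
  (Ideal.absNorm v.asIdeal : ℝ) ^ (-(multiplicity v.asIdeal (Ideal.span {x}) : ℤ))

theorem finAbs_le_one {K : Type*} [Field K] [NumberField K]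
    (v : HeightOneSpectrum (𝓞 K)) (x : 𝓞 K) : finAbs v x ≤ 1 := by
  have h : (1 : ℝ) ≤ (Ideal.absNorm v.asIdeal : ℝ) := by
    exact_mod_cast Nat.one_le_iff_ne_zero.mpr (Ideal.absNorm_eq_zero_iff.not.mpr v.ne_bot)
  exact zpow_le_one_of_nonpos₀ h (by simp)

theorem finAbs_unit {K : Type*} [Field K] [NumberField K]
    (v : HeightOneSpectrum (𝓞 K)) {x : 𝓞 K} (hx : IsUnit x) : finAbs v x = 1 := by
  have h : multiplicity v.asIdeal (Ideal.span {x}) = 0 := by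
    refine multiplicity_eq_zero.mpr fun hdvd => v.isPrime.ne_top ?_
    rw [Ideal.span_singleton_eq_top.mpr hx] at hdvd
    exact top_le_iff.mp (Ideal.le_of_dvd hdvd)
  simp [finAbs, h]

theorem prod_infinitePlace_eq_abs_norm_int {K : Type*} [Field K] [NumberField K] (x : 𝓞 K) :
    ∏ w : InfinitePlace K, w (algebraMap (𝓞 K) K x) ^ w.mult =
      |((Algebra.norm ℤ x : ℤ) : ℝ)| := by
  rw [InfinitePlace.prod_eq_abs_norm, ← Algebra.coe_norm_int]
  push_cast
  rfl

/-- If `K` satisfies the generalized abc-conjecture (with the product over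
all places of `K`, normalized absolute values, infinite places counted with their
multiplicity), then `K` satisfies the abc-inequality for units: for every `ε > 0` there is
`C' > 0` such that `|N_{K/ℚ}(u₁ − u₂)| ≤ C' · Rad((u₁ − u₂))^(1+ε)` for all units
`u₁ ≠ u₂` of `𝓞 K`. -/
theorem abc_conjecture_implies_abc_for_units
    (K : Type*) [Field K] [NumberField K]
    (habc : ∀ ε : ℝ, 0 < ε → ∃ C : ℝ, 0 < C ∧
      ∀ a b c : 𝓞 K, a ≠ 0 → b ≠ 0 → c ≠ 0 → a + b = c →
        IsCoprime (Ideal.span {a}) (Ideal.span {b}) →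
          (∏ w : InfinitePlace K,
              max (w (algebraMap (𝓞 K) K a))
                (max (w (algebraMap (𝓞 K) K b)) (w (algebraMap (𝓞 K) K c))) ^ w.mult) *
            (∏ᶠ v : HeightOneSpectrum (𝓞 K),
              max (finAbs v a) (max (finAbs v b) (finAbs v c))) ≤
          C * (Rad (Ideal.span {a * b * c}) : ℝ) ^ (1 + ε)) :
    ∀ ε : ℝ, 0 < ε → ∃ C' : ℝ, 0 < C' ∧
      ∀ u₁ u₂ : (𝓞 K)ˣ, u₁ ≠ u₂ →
        |((Algebra.norm ℤ ((u₁ : 𝓞 K) - (u₂ : 𝓞 K)) : ℤ) : ℝ)| ≤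
          C' * (Rad (Ideal.span {(u₁ : 𝓞 K) - (u₂ : 𝓞 K)}) : ℝ) ^ (1 + ε) := by
  intro ε hε
  obtain ⟨C, hC, h⟩ := habc ε hε
  refine ⟨C, hC, fun u₁ u₂ hne => ?_⟩
  have hc : (u₁ : 𝓞 K) - u₂ ≠ 0 := sub_ne_zero.mpr fun e => hne (Units.ext e)
  have key := h u₁ (-u₂) (u₁ - u₂) u₁.ne_zero (neg_ne_zero.mpr u₂.ne_zero) hc
    (sub_eq_add_neg _ _).symm
    (Ideal.isCoprime_iff_sup_eq.mpr
      (by rw [Ideal.span_singleton_eq_top.mpr u₁.isUnit, top_sup_eq]))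
  have hfin : ∏ᶠ v : HeightOneSpectrum (𝓞 K), max (finAbs v (u₁ : 𝓞 K))
      (max (finAbs v (-(u₂ : 𝓞 K))) (finAbs v ((u₁ : 𝓞 K) - u₂))) = 1 := by
    refine finprod_eq_one_of_forall_eq_one fun v => ?_
    rw [finAbs_unit v u₁.isUnit]
    exact max_eq_left (max_le (finAbs_le_one v _) (finAbs_le_one v _))
  have hspan : Ideal.span {(u₁ : 𝓞 K) * -u₂ * (u₁ - u₂)} =
      Ideal.span {(u₁ : 𝓞 K) - u₂} :=
    Ideal.span_singleton_mul_left_unit (u₁.isUnit.mul u₂.isUnit.neg) _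
  rw [hfin, mul_one, hspan] at key
  rw [← prod_infinitePlace_eq_abs_norm_int]
  refine le_trans (Finset.prod_le_prod (fun w _ => by positivity) fun w _ => ?_) key
  gcongr
  exact le_max_of_le_right (le_max_right _ _)
end
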